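/- There exists a constant C > 0 depending only on σ and β (in particular independent of ε, N and of the mesh-generating function φ) such that Σ_{i=1}^{N/4} Θ_i ≤ C. -/

import Mathlib

/-- A layer-adapted mesh for a singularly perturbed reaction–diffusion problem,
with parameters `β, σ > 0`, number of elements `N` (a multiple of 4, `N ≥ 4`),
perturbation parameter `ε` with `√ε ≤ N⁻¹`, and mesh-generating function `φ`
(with derivative `φ'` on `[0, 1/4]`). -/
structure LayerMesh (β σ : ℝ) (N : ℕ) (ε : ℝ) (φ φ' : ℝ → ℝ) where
  hβ : 0 < β
  hσ : 0 < σ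
  hN : 4 ≤ N
  hN4 : N % 4 = 0
  hε : 0 < ε
  hεN : Real.sqrt ε ≤ (N : ℝ)⁻¹
  hderiv : ∀ t ∈ Set.Icc (0:ℝ) (1/4), HasDerivWithinAt φ (φ' t) (Set.Icc (0:ℝ) (1/4)) t
  hcont : ContinuousOn φ' (Set.Icc (0:ℝ) (1/4))
  hφ0 : φ 0 = 0
  hφ'pos : ∀ t ∈ Set.Icc (0:ℝ) (1/4), 0 < φ' t
  hφ'mono : ∀ s ∈ Set.Icc (0:ℝ) (1/4), ∀ t ∈ Set.Icc (0:ℝ) (1/4), s ≤ t → φ' s ≤ φ' t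
  hτ : σ * Real.sqrt ε / β * φ (1/4) ≤ 1/4
  x : ℕ → ℝ
  hx_left : ∀ i : ℕ, i ≤ N / 4 → x i = σ * Real.sqrt ε / β * φ ((i : ℝ) / (N : ℝ))
  hx_mid : ∀ i : ℕ, N / 4 < i → i < 3 * N / 4 →
    x i = σ * Real.sqrt ε / β * φ (1/4)
      + 2 * (1 - 2 * (σ * Real.sqrt ε / β * φ (1/4))) * ((i : ℝ) / (N : ℝ) - 1/4)
  hx_right : ∀ i : ℕ, 3 * N / 4 ≤ i → i ≤ N →
    x i = 1 - σ * Real.sqrt ε / β * φ (1 - (i : ℝ) / (N : ℝ))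

namespace LayerMesh

variable {β σ ε : ℝ} {N : ℕ} {φ φ' : ℝ → ℝ}

/-- The mesh width `h_i = x_i − x_{i−1}`. -/
noncomputable def h (M : LayerMesh β σ N ε φ φ') (i : ℕ) : ℝ := M.x i - M.x (i - 1)

/-- The quantity `Θ_i = min{h_i/√ε, 1} · e^{−β x_{i−1}/(σ√ε)}`, for `1 ≤ i ≤ N/4`. -/
noncomputable def Θ (M : LayerMesh β σ N ε φ φ') (i : ℕ) : ℝ :=
  min (M.h i / Real.sqrt ε) 1 * Real.exp (-(β * M.x (i - 1)) / (σ * Real.sqrt ε))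

end LayerMesh

/-- `sup_{t ∈ [0,1/4]} |ψ'(t)|` where `ψ = e^{−φ}`, so `ψ' = −φ'·e^{−φ}`. -/
noncomputable def psiSup (φ φ' : ℝ → ℝ) : ℝ :=
  sSup ((fun t => |(-(φ' t)) * Real.exp (-(φ t))|) '' Set.Icc (0:ℝ) (1/4))

theorem min_mul_one_le_mul_one_sub_exp_neg {c d : ℝ} (hd : 0 ≤ d) :
    min (c * d) 1 ≤ (c + 1) * (1 - Real.exp (-d)) := by
  set m := min (c * d) 1 with hm
  have h₁ : m ≤ c * d := min_le_left _ _
  have h₂ : m ≤ 1 := min_le_right _ _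
  rcases le_or_gt 0 (c + 1) with hc | hc
  · have hexp : Real.exp (-d) ≤ (1 + d)⁻¹ := by
      rw [Real.exp_neg]
      exact inv_anti₀ (by linarith) (by linarith [Real.add_one_le_exp d])
    calc m ≤ (c + 1) * (1 - (1 + d)⁻¹) := by
          have hpos : 0 < 1 + d := by linarith
          have : (c + 1) * (1 - (1 + d)⁻¹) = (c + 1) * d / (1 + d) := by
            field_simp
            ring
          rw [this, le_div_iff₀ hpos]
          nlinarith
      _ ≤ (c + 1) * (1 - Real.exp (-d)) := by gcongr
  · have := Real.add_one_le_exp (-d)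
    nlinarith

namespace LayerMesh

variable {β σ ε : ℝ} {N : ℕ} {φ φ' : ℝ → ℝ}

theorem monotoneOn_generator (M : LayerMesh β σ N ε φ φ') :
    MonotoneOn φ (Set.Icc (0 : ℝ) (1 / 4)) :=
  monotoneOn_of_hasDerivWithinAt_nonneg (convex_Icc _ _)
    (fun t ht => (M.hderiv t ht).continuousWithinAt)
    (fun t ht => (M.hderiv t (interior_subset ht)).mono interior_subset)
    (fun t ht => (M.hφ'pos t (interior_subset ht)).le)

theorem div_mem_Icc (M : LayerMesh β σ N ε φ φ') {i : ℕ} (hi : i ≤ N / 4) :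
    (i : ℝ) / N ∈ Set.Icc (0 : ℝ) (1 / 4) := by
  have hN := M.hN
  have hN0 : (0 : ℝ) < N := by exact_mod_cast (by omega : 0 < N)
  have h4 : (i : ℝ) * 4 ≤ N := by exact_mod_cast (by omega : i * 4 ≤ N)
  refine ⟨by positivity, ?_⟩
  rw [div_le_iff₀ hN0]
  linarith

theorem Θ_succ_le (M : LayerMesh β σ N ε φ φ') {n : ℕ} (hn : n + 1 ≤ N / 4) :
    M.Θ (n + 1) ≤ (σ / β + 1) *
      (Real.exp (-φ ((n : ℝ) / N)) - Real.exp (-φ (((n + 1 : ℕ) : ℝ) / N))) := by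
  have hβ := M.hβ
  have hσ := M.hσ
  have hε : 0 < Real.sqrt ε := Real.sqrt_pos.mpr M.hε
  have hmono : φ ((n : ℝ) / N) ≤ φ (((n + 1 : ℕ) : ℝ) / N) :=
    M.monotoneOn_generator (M.div_mem_Icc (by omega)) (M.div_mem_Icc hn)
      (by gcongr; omega)
  have hx := M.hx_left n (by omega)
  have hx' := M.hx_left (n + 1) hn
  set a := φ ((n : ℝ) / N)
  set b := φ (((n + 1 : ℕ) : ℝ) / N)
  have hΘ : M.Θ (n + 1) = min (σ / β * (b - a)) 1 * Real.exp (-a) := by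
    unfold Θ h
    rw [Nat.add_sub_cancel, hx, hx']
    congr 2
    · field_simp
    · field_simp
  have hexp : Real.exp (-b) = Real.exp (-(b - a)) * Real.exp (-a) := by
    rw [← Real.exp_add]
    ring_nf
  calc M.Θ (n + 1) = min (σ / β * (b - a)) 1 * Real.exp (-a) := hΘ
    _ ≤ (σ / β + 1) * (1 - Real.exp (-(b - a))) * Real.exp (-a) := by
        gcongr
        exact min_mul_one_le_mul_one_sub_exp_neg (sub_nonneg.mpr hmono)
    _ = (σ / β + 1) * (Real.exp (-a) - Real.exp (-b)) := by
        rw [hexp]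
        ring

theorem sum_Θ_le (M : LayerMesh β σ N ε φ φ') {n : ℕ} (hn : n ≤ N / 4) :
    ∑ i ∈ Finset.Icc 1 n, M.Θ i ≤ (σ / β + 1) * (1 - Real.exp (-φ ((n : ℝ) / N))) := by
  induction n with
  | zero => simp [M.hφ0]
  | succ n ih =>
    rw [Finset.sum_Icc_succ_top (by omega)]
    linarith [ih (by omega), M.Θ_succ_le hn]

end LayerMesh

theorem stmt1 (β σ : ℝ) (hβ : 0 < β) (hσ : 0 < σ) :
    ∃ C : ℝ, 0 < C ∧
      ∀ (N : ℕ) (ε : ℝ) (φ φ' : ℝ → ℝ) (M : LayerMesh β σ N ε φ φ'),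
        ∑ i ∈ Finset.Icc 1 (N / 4), M.Θ i ≤ C := by
  refine ⟨σ / β + 1, by positivity, fun N ε φ φ' M => (M.sum_Θ_le le_rfl).trans ?_⟩
  exact mul_le_of_le_one_right (by positivity) (by linarith [Real.exp_pos (-φ ((N / 4 : ℕ) / N))])
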